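/- Let A = B·D be a real m×n matrix of full column rank, where D is an n×n diagonal matrix with positive diagonal entries, let Ṽ be a real n×n orthogonal matrix, and let ΔX be a real m×n matrix with |ΔX| ≤ ε |A| |Ṽ| entrywise for some ε ≥ 0. Then for all i, j ≤ n, |(ΔXᵀ ΔX)_{ij}| ≤ n³ ε² κ(B)² ‖A Ṽ(:,i)‖₂ · ‖A Ṽ(:,j)‖₂. -/

import Mathlib

open Matrix BigOperators

/-- Euclidean norm of a vector. -/
noncomputable def vnorm {k : ℕ} (v : Fin k → ℝ) : ℝ := Real.sqrt (∑ i, (v i)^2)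

/-- Spectral norm (operator 2-norm) of a real matrix. -/
noncomputable def spec {m n : ℕ} (A : Matrix (Fin m) (Fin n) ℝ) : ℝ :=
  ‖(Matrix.toEuclideanLin A).toContinuousLinearMap‖

/-- Moore–Penrose pseudoinverse of a full-column-rank matrix. -/
noncomputable def pinv {m n : ℕ} (A : Matrix (Fin m) (Fin n) ℝ) : Matrix (Fin n) (Fin m) ℝ :=
  (Aᵀ * A)⁻¹ * Aᵀ

/-- Condition number κ(B) = ‖B‖ ‖B†‖. -/
noncomputable def kappa {m n : ℕ} (B : Matrix (Fin m) (Fin n) ℝ) : ℝ :=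
  spec B * spec (pinv B)

theorem vnorm_eq_norm {k : ℕ} (v : Fin k → ℝ) : vnorm v = ‖WithLp.toLp 2 v‖ := by
  simp [vnorm, EuclideanSpace.norm_eq]

theorem vnorm_nonneg {k : ℕ} (v : Fin k → ℝ) : 0 ≤ vnorm v := Real.sqrt_nonneg _

theorem vnorm_mono {k : ℕ} {v w : Fin k → ℝ} (h : ∀ i, |v i| ≤ w i) : vnorm v ≤ vnorm w :=
  Real.sqrt_le_sqrt <| Finset.sum_le_sum fun i _ => sq_le_sq' (abs_le.mp (h i)).1
    (abs_le.mp (h i)).2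

theorem abs_le_vnorm {k : ℕ} (v : Fin k → ℝ) (i : Fin k) : |v i| ≤ vnorm v :=
  Real.abs_le_sqrt <|
    Finset.single_le_sum (f := fun i => v i ^ 2) (fun i _ => sq_nonneg (v i)) (Finset.mem_univ i)

theorem vnorm_smul {k : ℕ} (c : ℝ) (v : Fin k → ℝ) : vnorm (c • v) = |c| * vnorm v := by
  rw [vnorm_eq_norm, vnorm_eq_norm, WithLp.toLp_smul, norm_smul, Real.norm_eq_abs]

theorem vnorm_sum_le {ι : Type*} {k : ℕ} (s : Finset ι) (f : ι → Fin k → ℝ) :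
    vnorm (∑ i ∈ s, f i) ≤ ∑ i ∈ s, vnorm (f i) := by
  simp only [vnorm_eq_norm, WithLp.toLp_sum]
  exact norm_sum_le _ _

theorem vnorm_mulVec_le {m n : ℕ} (A : Matrix (Fin m) (Fin n) ℝ) (x : Fin n → ℝ) :
    vnorm (A *ᵥ x) ≤ spec A * vnorm x := by
  rw [vnorm_eq_norm, vnorm_eq_norm]
  exact (Matrix.toEuclideanLin A).toContinuousLinearMap.le_opNorm (WithLp.toLp 2 x)

theorem vnorm_col_le_spec {m n : ℕ} (A : Matrix (Fin m) (Fin n) ℝ) (k : Fin n) :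
    vnorm (fun r => A r k) ≤ spec A := by
  have h := vnorm_mulVec_le A (Pi.single k 1)
  have h1 : vnorm (Pi.single k (1 : ℝ)) = 1 := by
    rw [vnorm_eq_norm]
    simp
  rw [h1, mul_one, mulVec_single_one] at h
  exact h

theorem vnorm_abs {k : ℕ} (v : Fin k → ℝ) : vnorm (fun i => |v i|) = vnorm v := by
  simp [vnorm]

/-- Cauchy–Schwarz for the entries of a Gram matrix. -/
theorem abs_transpose_mul_self_apply_le {m n : ℕ} (X : Matrix (Fin m) (Fin n) ℝ) (i j : Fin n) :
    |(Xᵀ * X) i j| ≤ vnorm (fun r => X r i) * vnorm (fun r => X r j) := by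
  have h := Finset.sum_mul_sq_le_sq_mul_sq Finset.univ (fun r => X r i) (fun r => X r j)
  rw [vnorm, vnorm, ← Real.sqrt_mul (Finset.sum_nonneg fun _ _ => sq_nonneg _)]
  apply Real.abs_le_sqrt
  simpa [mul_apply] using h

theorem pinv_mul_self {m n : ℕ} {B : Matrix (Fin m) (Fin n) ℝ} (h : B.rank = n) :
    pinv B * B = 1 := by
  have hu : IsUnit (Bᵀ * B) := by
    rw [← Matrix.linearIndependent_cols_iff_isUnit, linearIndependent_iff_card_eq_finrank_span,
      Set.finrank, ← Matrix.rank_eq_finrank_span_cols, Matrix.rank_transpose_mul_self, h,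
      Fintype.card_fin]
  rw [pinv, Matrix.mul_assoc, Matrix.nonsing_inv_mul _ ((Matrix.isUnit_iff_isUnit_det _).mp hu)]

/-- Columnwise bound: the entrywise product `|B| |D V|` costs a factor `n κ(B)`. -/
theorem vnorm_col_le_of_abs_le {m n : ℕ} {B : Matrix (Fin m) (Fin n) ℝ} {d : Fin n → ℝ}
    (hB : B.rank = n) (V : Matrix (Fin n) (Fin n) ℝ)
    (X : Matrix (Fin m) (Fin n) ℝ) {ε : ℝ} (hε : 0 ≤ ε)
    (hX : ∀ i j, |X i j| ≤
      ε * (((B * diagonal d).map (fun x => |x|) * V.map (fun x => |x|)) i j)) (i : Fin n) :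
    vnorm (fun r => X r i) ≤
      n * ε * kappa B * vnorm (fun k => (B * diagonal d * V) k i) := by
  set y : Fin n → ℝ := fun k => d k * V k i with hy
  set z : Fin m → ℝ := fun k => (B * diagonal d * V) k i with hz
  have hzy : z = B *ᵥ y := by
    ext r
    simp [hz, hy, mul_assoc, mul_apply, mulVec, dotProduct, diagonal_apply]
  have hyz : y = pinv B *ᵥ z := by
    rw [hzy, mulVec_mulVec, pinv_mul_self hB, one_mulVec]
  have hyn : vnorm y ≤ spec (pinv B) * vnorm z := by
    conv_lhs => rw [hyz]
    exact vnorm_mulVec_le _ _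
  calc vnorm (fun r => X r i)
      ≤ vnorm (∑ k, (ε * |y k|) • fun r => |B r k|) := by
        refine vnorm_mono fun r => (hX r i).trans_eq ?_
        rw [mul_apply]
        simp only [map_apply, Finset.sum_apply, Pi.smul_apply, smul_eq_mul,
          Finset.mul_sum, mul_diagonal, hy, abs_mul]
        exact Finset.sum_congr rfl fun k _ => by ring
    _ ≤ ∑ k, vnorm ((ε * |y k|) • fun r => |B r k|) := vnorm_sum_le _ _
    _ ≤ ∑ _k : Fin n, ε * (spec (pinv B) * vnorm z) * spec B := by
        refine Finset.sum_le_sum fun k _ => ?_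
        rw [vnorm_smul, vnorm_abs, abs_of_nonneg (by positivity)]
        have h1 := (abs_le_vnorm y k).trans hyn
        have h2 := vnorm_col_le_spec B k
        have h3 := vnorm_nonneg fun r => B r k
        have h4 := (abs_nonneg _).trans h1
        gcongr
    _ = n * ε * kappa B * vnorm z := by
        simp [kappa]
        ring

/-- bound on |(ΔXᵀ ΔX)_{ij}|. -/
theorem stmt_10 {m n : ℕ} (A B : Matrix (Fin m) (Fin n) ℝ)
    (d : Fin n → ℝ) (hd : ∀ i, 0 < d i)
    (hA : A = B * Matrix.diagonal d) (hrank : A.rank = n)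
    (V : Matrix (Fin n) (Fin n) ℝ) (hV : Vᵀ * V = 1)
    (ΔX : Matrix (Fin m) (Fin n) ℝ) (ε : ℝ) (hε : 0 ≤ ε)
    (hΔX : ∀ i j, |ΔX i j| ≤
      ε * ((A.map (fun x => |x|) * V.map (fun x => |x|)) i j)) :
    ∀ i j, |(ΔXᵀ * ΔX) i j| ≤ (n : ℝ)^3 * ε^2 * kappa B ^ 2 *
      (vnorm (fun k => (A * V) k i) * vnorm (fun k => (A * V) k j)) := by
  intro i j
  subst hA
  have hB : B.rank = n := le_antisymm
    (by simpa using B.rank_le_card_width) (hrank.symm.le.trans (rank_mul_le_left _ _))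
  have hi := vnorm_col_le_of_abs_le hB V ΔX hε hΔX i
  have hj := vnorm_col_le_of_abs_le hB V ΔX hε hΔX j
  set a := vnorm (fun k => (B * diagonal d * V) k i)
  set b := vnorm (fun k => (B * diagonal d * V) k j)
  have ha : 0 ≤ a := vnorm_nonneg _
  have hb : 0 ≤ b := vnorm_nonneg _
  have hn : (1 : ℝ) ≤ n := by exact_mod_cast Nat.one_le_of_lt i.2
  calc |(ΔXᵀ * ΔX) i j|
      ≤ vnorm (fun r => ΔX r i) * vnorm (fun r => ΔX r j) :=
        abs_transpose_mul_self_apply_le ΔX i j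
    _ ≤ (n * ε * kappa B * a) * (n * ε * kappa B * b) :=
        mul_le_mul hi hj (vnorm_nonneg _) ((vnorm_nonneg _).trans hi)
    _ = (n : ℝ) ^ 2 * ε ^ 2 * kappa B ^ 2 * (a * b) := by ring
    _ ≤ (n : ℝ) ^ 3 * ε ^ 2 * kappa B ^ 2 * (a * b) := by
        gcongr
        norm_num
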